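/- Let A be a unital locally AF C*-algebra and B_0 ⊆ A a unital separable C*-subalgebra. Then there exists a unital separable AF C*-subalgebra B of A containing B_0. -/

import Mathlib

open Filter Topology

section Spectral

variable {A : Type*} [CStarAlgebra A] {D : StarSubalgebra ℂ A}

theorem StarSubalgebra.real_aeval_mem {a : A} (ha : a ∈ D) (q : Polynomial ℝ) :
    Polynomial.aeval a q ∈ D :=
  Algebra.adjoin_le (S := D.toSubalgebra.restrictScalars ℝ) (by simpa using ha)
    (Polynomial.aeval_mem_adjoin_singleton ℝ a)

theorem StarSubalgebra.finite_real_spectrum [FiniteDimensional ℂ D] {a : A} (ha : a ∈ D) :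
    (spectrum ℝ a).Finite := by
  have : FiniteDimensional ℝ D := Module.Finite.trans ℂ D
  have hint : IsIntegral ℝ (⟨a, ha⟩ : D) := Algebra.IsIntegral.isIntegral _
  have h0 : Polynomial.aeval a (minpoly ℝ (⟨a, ha⟩ : D)) = 0 := by
    have h := congrArg (fun x : D => (x : A)) (minpoly.aeval ℝ (⟨a, ha⟩ : D))
    have h2 := Polynomial.aeval_algHom_apply ((D.subtype : D →ₐ[ℂ] A).restrictScalars ℝ)
      (⟨a, ha⟩ : D) (minpoly ℝ (⟨a, ha⟩ : D))
    simpa [h] using h2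
  refine ((minpoly ℝ (⟨a, ha⟩ : D)).rootSet_finite ℝ).subset fun x hx => ?_
  have hx' := spectrum.subset_polynomial_aeval a (minpoly ℝ (⟨a, ha⟩ : D)) ⟨x, hx, rfl⟩
  rw [h0] at hx'
  have : Nontrivial A := by
    by_contra h
    rw [not_nontrivial_iff_subsingleton] at h
    simp [spectrum.of_subsingleton] at hx
  rw [spectrum.zero_eq, Set.mem_singleton_iff] at hx'
  rw [Polynomial.mem_rootSet]
  exact ⟨minpoly.ne_zero hint, by simpa using hx'⟩

theorem StarSubalgebra.continuousOn_spectrum [FiniteDimensional ℂ D] {a : A} (ha : a ∈ D)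
    (f : ℝ → ℝ) : ContinuousOn f (spectrum ℝ a) :=
  (finite_real_spectrum ha).continuousOn f

theorem StarSubalgebra.cfc_mem [FiniteDimensional ℂ D] {a : A} (ha : a ∈ D) (f : ℝ → ℝ) :
    cfc f a ∈ D := by
  by_cases hsa : IsSelfAdjoint a
  · have hfin := finite_real_spectrum ha
    set q := Lagrange.interpolate hfin.toFinset id f
    have : cfc f a = cfc q.eval a := cfc_congr fun x hx =>
      (Lagrange.eval_interpolate_at_node f (v := id) (Set.injOn_id _)
        (hfin.mem_toFinset.2 hx)).symm
    rw [this, cfc_polynomial q a]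
    exact real_aeval_mem ha q
  · rw [cfc_apply_of_not_predicate a hsa]
    exact zero_mem D

/-- The spectral projection of a self-adjoint element on `(1/2, ∞)`. -/
theorem StarSubalgebra.exists_isStarProjection_near [FiniteDimensional ℂ D] {y p : A}
    (hyD : y ∈ D) (hy : IsSelfAdjoint y) (hp : IsStarProjection p) {δ : ℝ} (hδ : ‖y - p‖ ≤ δ)
    (hδ1 : δ ≤ 1) :
    ∃ q ∈ D, IsStarProjection q ∧ ‖q - p‖ ≤ 9 * δ ∧ ∀ z, z * y = 0 → z * q = 0 := by
  classical
  have hc (f : ℝ → ℝ) : ContinuousOn f (spectrum ℝ y) := continuousOn_spectrum hyD f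
  set f : ℝ → ℝ := fun t => if 1 / 2 < t then 1 else 0 with hf
  have hp1 : ‖p‖ ≤ 1 := hp.norm_le
  have hy2 : ‖y‖ ≤ 2 := by
    calc ‖y‖ = ‖(y - p) + p‖ := by simp
      _ ≤ _ := (norm_add_le _ _).trans (by linarith)
  have hyy : ‖y * y - y‖ ≤ 4 * δ := by
    have : y * y - y = y * (y - p) + (y - p) * p - (y - p) := by
      have := hp.isIdempotentElem.eq
      simp only [mul_sub, sub_mul, this]; abel
    rw [this]
    have h1 := norm_mul_le y (y - p)
    have h2 := norm_mul_le (y - p) p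
    have h3 := norm_sub_le (y * (y - p) + (y - p) * p) (y - p)
    have h4 := norm_add_le (y * (y - p)) ((y - p) * p)
    have := norm_nonneg (y - p)
    nlinarith
  have hcf : cfc (fun t : ℝ => t * t - t) y = y * y - y := by
    rw [cfc_sub _ _ y (hc _) (hc _), cfc_mul _ _ y (hc _) (hc _), cfc_id' ℝ y]
  have hqy : ‖cfc f y - y‖ ≤ 2 * ‖y * y - y‖ := by
    have : cfc f y - y = cfc (fun t => f t - t) y := by
      rw [cfc_sub _ _ y (hc _) (hc _), cfc_id' ℝ y]
    rw [this]
    refine norm_cfc_le (by positivity) fun t ht => ?_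
    have h1 := norm_apply_le_norm_cfc (fun t : ℝ => t * t - t) y ht (hc _)
    rw [hcf, Real.norm_eq_abs] at h1
    refine le_trans ?_ (mul_le_mul_of_nonneg_left h1 zero_le_two)
    have h2 : t * t - t = t * (t - 1) := by ring
    rw [Real.norm_eq_abs, h2, abs_mul]
    simp only [hf]
    split_ifs with h
    · rw [abs_sub_comm 1 t, abs_of_pos (by linarith : 0 < t)]
      nlinarith [abs_nonneg (t - 1)]
    · rw [zero_sub, abs_neg, abs_sub_comm t 1, abs_of_pos (by linarith : 0 < 1 - t)]
      nlinarith [abs_nonneg t]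
  refine ⟨cfc f y, cfc_mem hyD f, ⟨?_, cfc_predicate f y⟩, ?_, fun z hz => ?_⟩
  · rw [IsIdempotentElem, ← cfc_mul f f y (hc _) (hc _)]
    exact cfc_congr fun t _ => by simp [hf]
  · calc ‖cfc f y - p‖ = ‖(cfc f y - y) + (y - p)‖ := by simp
      _ ≤ _ := (norm_add_le _ _).trans (by linarith)
  · have : cfc f y = y * cfc (fun t : ℝ => if 1 / 2 < t then t⁻¹ else 0) y := by
      conv_rhs => enter [1]; rw [← cfc_id' ℝ y]
      rw [← cfc_mul _ _ y (hc _) (hc _)]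
      refine cfc_congr fun t _ => ?_
      simp only [hf]
      split_ifs with h
      · rw [mul_inv_cancel₀ (by linarith)]
      · simp
    rw [this, ← mul_assoc, hz, zero_mul]

/-- Two close projections are conjugate by a unitary close to `1`. -/
theorem IsStarProjection.exists_unitary_intertwining {p q : A} (hp : IsStarProjection p)
    (hq : IsStarProjection q) {d : ℝ} (hd : ‖p - q‖ ≤ d) (hd2 : d ≤ 1 / 2) :
    ∃ u ∈ unitary A, u * p = q * u ∧ ‖u - 1‖ ≤ 3 * d ∧
      ∀ r, Commute p r → Commute q r → Commute u r := by
  have hpp := hp.isIdempotentElem.eq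
  have hqq := hq.isIdempotentElem.eq
  have hps := hp.isSelfAdjoint.star_eq
  have hqs := hq.isSelfAdjoint.star_eq
  have hd0 : 0 ≤ d := (norm_nonneg _).trans hd
  set x := 1 - q - p + 2 * (q * p) with hx
  set z := 1 - (p - q) * (p - q) with hz
  have hz' : z = 1 - p - q + p * q + q * p := by
    simp only [hz, mul_sub, sub_mul, hpp, hqq]; abel
  have hsx : star x = 1 - q - p + 2 * (p * q) := by
    simp [hx, hps, hqs, two_mul]
  have hpp' (a : A) : p * (p * a) = p * a := by rw [← mul_assoc, hpp]
  have hqq' (a : A) : q * (q * a) = q * a := by rw [← mul_assoc, hqq]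
  have hxx : star x * x = z := by
    rw [hsx, hx, hz']
    simp only [two_mul, mul_add, add_mul, mul_sub, sub_mul, mul_one, one_mul, mul_assoc, hpp, hqq,
      hqq']
    abel
  have hxx' : x * star x = z := by
    rw [hsx, hx, hz']
    simp only [two_mul, mul_add, add_mul, mul_sub, sub_mul, mul_one, one_mul, mul_assoc, hpp, hqq,
      hpp']
    abel
  have hzsa : IsSelfAdjoint z := hxx ▸ IsSelfAdjoint.star_mul_self x
  have hpz : Commute z p := by
    rw [commute_iff_eq, hz']
    simp only [mul_add, add_mul, mul_sub, sub_mul, mul_one, one_mul, mul_assoc, hpp, hpp']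
    abel
  have hqz : Commute z q := by
    rw [commute_iff_eq, hz']
    simp only [mul_add, add_mul, mul_sub, sub_mul, mul_one, one_mul, mul_assoc, hqq, hqq']
    abel
  have hd_sq : ‖z - 1‖ ≤ d * d := by
    have : z - 1 = -((p - q) * (p - q)) := by rw [hz]; abel
    rw [this, norm_neg]
    exact (norm_mul_le _ _).trans (by gcongr)
  have hspec : ∀ t ∈ spectrum ℝ z, |t - 1| ≤ d * d := fun t ht => by
    have h1 := norm_apply_le_norm_cfc (fun t : ℝ => t - 1) z ht
    rw [cfc_sub _ _ z, cfc_id' ℝ z, cfc_const_one ℝ z] at h1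
    exact h1.trans hd_sq
  have hhalf : ∀ t ∈ spectrum ℝ z, 1 / 2 ≤ t := fun t ht => by
    have := abs_le.1 (hspec t ht)
    nlinarith
  have hc : ContinuousOn (fun t : ℝ => (√t)⁻¹) (spectrum ℝ z) :=
    Real.continuous_sqrt.continuousOn.inv₀ fun t ht =>
      (Real.sqrt_pos.2 (by linarith [hhalf t ht])).ne'
  set w := cfc (fun t : ℝ => (√t)⁻¹) z with hw
  have hws : star w = w := (cfc_predicate (fun t : ℝ => (√t)⁻¹) z : IsSelfAdjoint w).star_eq
  have hwz (r : A) (hr : Commute z r) : Commute w r := hr.cfc_real _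
  have hwp := hwz p hpz
  have hwx : Commute w x := by
    refine hwz x ?_
    rw [hx]
    exact (((Commute.one_right z).sub_right hqz).sub_right hpz).add_right
      ((Commute.ofNat_right z 2).mul_right (hqz.mul_right hpz))
  have hwwz : w * w * z = 1 := by
    have : cfc (fun t : ℝ => (√t)⁻¹ * (√t)⁻¹ * t) z = w * w * z := by
      rw [cfc_mul (fun t : ℝ => (√t)⁻¹ * (√t)⁻¹) (fun t => t) z (hc.mul hc), cfc_mul _ _ z hc hc,
        cfc_id' ℝ z]
    rw [← this, ← cfc_const_one ℝ z]
    refine cfc_congr fun t ht => ?_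
    have h0 : 0 < t := by linarith [hhalf t ht]
    have := Real.mul_self_sqrt h0.le
    have h1 := (Real.sqrt_pos.2 h0).ne'
    field_simp
    nlinarith
  have hw1 : ‖w - 1‖ ≤ d * d := by
    have : w - 1 = cfc (fun t : ℝ => (√t)⁻¹ - 1) z := by
      rw [cfc_sub _ _ z hc, cfc_const_one ℝ z]
    rw [this]
    refine norm_cfc_le (by positivity) fun t ht => ?_
    refine le_trans ?_ (hspec t ht)
    have h0 : 0 < t := by linarith [hhalf t ht]
    set s := √t with hs
    have hs0 : 0 < s := Real.sqrt_pos.2 h0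
    have hst : s * s = t := Real.mul_self_sqrt h0.le
    have h12 := hhalf t ht
    have hs12 : 1 / 2 ≤ s := by nlinarith
    have h3 : s⁻¹ - 1 = -((s - 1) / s) := by field_simp; ring
    have h4 : t - 1 = (s - 1) * (s + 1) := by rw [← hst]; ring
    rw [h3, h4, Real.norm_eq_abs, abs_neg, abs_div, abs_mul, abs_of_pos hs0,
      abs_of_pos (by linarith : 0 < s + 1), div_le_iff₀ hs0, mul_assoc]
    refine le_mul_of_one_le_right (abs_nonneg _) ?_
    nlinarith
  have hx1 : ‖x - 1‖ ≤ 2 * d := by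
    have : x - 1 = q * (p - q) + (q - p) * p := by
      simp only [hx, two_mul, mul_sub, sub_mul, hpp, hqq]; abel
    rw [this]
    have h1 := norm_mul_le q (p - q)
    have h2 := norm_mul_le (q - p) p
    rw [norm_sub_rev q p] at h2
    have h3 := norm_add_le (q * (p - q)) ((q - p) * p)
    have h4 : ‖p‖ ≤ 1 := hp.norm_le
    have h5 : ‖q‖ ≤ 1 := hq.norm_le
    have := norm_nonneg (p - q)
    nlinarith
  refine ⟨x * w, ?_, ?_, ?_, fun r hpr hqr => ?_⟩
  · rw [Unitary.mem_iff, star_mul, hws]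
    constructor
    · calc w * star x * (x * w) = w * (star x * x) * w := by noncomm_ring
        _ = w * w * z := by rw [hxx, mul_assoc, mul_assoc, (hwz z (Commute.refl z)).eq]
        _ = 1 := hwwz
    · calc x * w * (w * star x) = (x * w) * w * star x := by noncomm_ring
        _ = w * w * (x * star x) := by rw [← hwx.eq, mul_assoc w x w, ← hwx.eq]; noncomm_ring
        _ = 1 := by rw [hxx', hwwz]
  · have h1 : x * p = q * x := by
      simp only [hx, two_mul, mul_add, add_mul, mul_sub, sub_mul, mul_one, one_mul, mul_assoc, hpp,
        hqq, hqq']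
      abel
    rw [mul_assoc, hwp.eq, ← mul_assoc, h1, mul_assoc]
  · have : x * w - 1 = (x - 1) * (w - 1) + (w - 1) + (x - 1) := by noncomm_ring
    rw [this]
    have h1 := norm_add₃_le (a := (x - 1) * (w - 1)) (b := w - 1) (c := x - 1)
    have h2 := norm_mul_le (x - 1) (w - 1)
    have h3 : ‖x - 1‖ * ‖w - 1‖ ≤ (2 * d) * (d * d) := by gcongr
    nlinarith [mul_nonneg hd0 hd0]
  · have hzr : Commute z r := by
      rw [hz]
      exact (Commute.one_left r).sub_left ((hpr.sub_left hqr).mul_left (hpr.sub_left hqr))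
    refine Commute.mul_left ?_ (hwz r hzr)
    rw [hx]
    exact (((Commute.one_left r).sub_left hqr).sub_left hpr).add_left
      ((Commute.ofNat_left 2 r).mul_left (hqr.mul_left hpr))

end Spectral

section Extension

universe u

variable {A : Type u} [CStarAlgebra A]

/-- Every finite subset of `A` is approximately contained in a finite-dimensional subalgebra
containing `D`. -/
def HasApproxExtensions (D : StarSubalgebra ℂ A) : Prop :=
  ∀ (F : Finset A) (ε : ℝ), 0 < ε → ∃ E : StarSubalgebra ℂ A, D ≤ E ∧
    FiniteDimensional ℂ E ∧ ∀ x ∈ F, ∃ y ∈ E, ‖x - y‖ < ε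

/-- The subalgebra of all `x` whose compressions `(v i)⋆ x (v j)` lie in `E`. -/
def StarSubalgebra.ofCompressions {ι : Type*} [Fintype ι] (E : StarSubalgebra ℂ A) (v : ι → A)
    (hv : ∑ i, v i * star (v i) = 1) (hvE : ∀ i j, star (v i) * v j ∈ E) :
    StarSubalgebra ℂ A where
  carrier := {x | ∀ i j, star (v i) * x * v j ∈ E}
  mul_mem' {x y} hx hy i j := by
    have : star (v i) * (x * y) * v j =
        ∑ k, (star (v i) * x * v k) * (star (v k) * y * v j) := by
      calc star (v i) * (x * y) * v j
          = star (v i) * x * (∑ k, v k * star (v k)) * (y * v j) := by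
            rw [hv]; noncomm_ring
        _ = _ := by
            rw [Finset.mul_sum, Finset.sum_mul]
            exact Finset.sum_congr rfl fun k _ => by noncomm_ring
    rw [this]
    exact sum_mem fun k _ => mul_mem (hx i k) (hy k j)
  add_mem' {x y} hx hy i j := by
    rw [mul_add, add_mul]
    exact add_mem (hx i j) (hy i j)
  algebraMap_mem' r i j := by
    rw [Algebra.algebraMap_eq_smul_one, mul_smul_comm, smul_mul_assoc, mul_one]
    exact SMulMemClass.smul_mem r (hvE i j)
  star_mem' {x} hx i j := by
    have := star_mem (hx j i)
    simpa [mul_assoc] using this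

theorem StarSubalgebra.mem_ofCompressions {ι : Type*} [Fintype ι] {E : StarSubalgebra ℂ A}
    {v : ι → A} {hv : ∑ i, v i * star (v i) = 1} {hvE : ∀ i j, star (v i) * v j ∈ E} {x : A} :
    x ∈ E.ofCompressions v hv hvE ↔ ∀ i j, star (v i) * x * v j ∈ E := Iff.rfl

theorem eq_sum_compressions {ι : Type*} [Fintype ι] {v : ι → A}
    (hv : ∑ i, v i * star (v i) = 1) (x : A) :
    x = ∑ i, ∑ j, v i * (star (v i) * x * v j) * star (v j) := by
  calc x = (∑ i, v i * star (v i)) * x * ∑ j, v j * star (v j) := by simp [hv]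
    _ = _ := by
      rw [Finset.sum_mul, Finset.sum_mul_sum]
      exact Finset.sum_congr rfl fun i _ => Finset.sum_congr rfl fun j _ => by noncomm_ring

instance StarSubalgebra.finiteDimensional_ofCompressions {ι : Type*} [Fintype ι]
    (E : StarSubalgebra ℂ A) [FiniteDimensional ℂ E] (v : ι → A)
    (hv : ∑ i, v i * star (v i) = 1) (hvE : ∀ i j, star (v i) * v j ∈ E) :
    FiniteDimensional ℂ (E.ofCompressions v hv hvE) := by
  let T : E.ofCompressions v hv hvE →ₗ[ℂ] ι → ι → E :=
    { toFun := fun x i j => ⟨star (v i) * (x : A) * v j, x.2 i j⟩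
      map_add' := fun x y => by ext i j; simp [mul_add, add_mul]
      map_smul' := fun c x => by ext i j; simp }
  refine Module.Finite.of_injective T fun x y hxy => Subtype.ext ?_
  rw [eq_sum_compressions hv (x : A), eq_sum_compressions hv (y : A)]
  refine Finset.sum_congr rfl fun i _ => Finset.sum_congr rfl fun j _ => ?_
  have := congrArg Subtype.val (congrFun (congrFun hxy i) j)
  simp only [T, LinearMap.coe_mk, AddHom.coe_mk] at this
  rw [this]

theorem HasApproxExtensions.of_compressions {ι : Type*} [Fintype ι]
    {C D : StarSubalgebra ℂ A} (hC : HasApproxExtensions C) (v : ι → A)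
    (hv : ∑ i, v i * star (v i) = 1) (hvD : ∀ d ∈ D, ∀ i j, star (v i) * d * v j ∈ C) :
    HasApproxExtensions D := by
  classical
  intro F ε hε
  set M : ℝ := ∑ i, ∑ j, ‖v i‖ * ‖star (v j)‖ with hM
  have hM0 : 0 ≤ M := by positivity
  obtain ⟨E, hCE, hE, hFE⟩ := hC
    (F.biUnion fun x => Finset.univ.image fun ij : ι × ι => star (v ij.1) * x * v ij.2)
    (ε / (M + 1)) (by positivity)
  have hvC : ∀ i j, star (v i) * v j ∈ C := fun i j => by simpa using hvD 1 (one_mem D) i j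
  refine ⟨E.ofCompressions v hv fun i j => hCE (hvC i j), fun d hd i j => hCE (hvD d hd i j),
    inferInstance, fun x hx => ?_⟩
  have hex : ∀ i j, ∃ y ∈ E, ‖star (v i) * x * v j - y‖ < ε / (M + 1) := fun i j =>
    hFE _ (Finset.mem_biUnion.2 ⟨x, hx, Finset.mem_image.2 ⟨(i, j), Finset.mem_univ _, rfl⟩⟩)
  choose e heE he using hex
  refine ⟨∑ i, ∑ j, v i * e i j * star (v j), fun k l => ?_, ?_⟩
  · rw [Finset.mul_sum, Finset.sum_mul]
    refine sum_mem fun i _ => ?_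
    rw [Finset.mul_sum, Finset.sum_mul]
    refine sum_mem fun j _ => ?_
    have : star (v k) * (v i * e i j * star (v j)) * v l =
      (star (v k) * v i) * e i j * (star (v j) * v l) := by noncomm_ring
    rw [this]
    exact mul_mem (mul_mem (hCE (hvC k i)) (heE i j)) (hCE (hvC j l))
  · have hlt : M * (ε / (M + 1)) < ε := by
      rw [mul_div_assoc', div_lt_iff₀ (by positivity)]
      nlinarith
    refine lt_of_le_of_lt ?_ hlt
    conv_lhs => rw [eq_sum_compressions hv x]
    rw [← Finset.sum_sub_distrib, hM, Finset.sum_mul]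
    refine (norm_sum_le _ _).trans (Finset.sum_le_sum fun i _ => ?_)
    rw [← Finset.sum_sub_distrib, Finset.sum_mul]
    refine (norm_sum_le _ _).trans (Finset.sum_le_sum fun j _ => ?_)
    rw [← sub_mul, ← mul_sub]
    calc _ ≤ ‖v i‖ * ‖star (v i) * x * v j - e i j‖ * ‖star (v j)‖ :=
          (norm_mul_le _ _).trans (by gcongr; exact norm_mul_le _ _)
      _ ≤ ‖v i‖ * (ε / (M + 1)) * ‖star (v j)‖ := by gcongr; exact (he i j).le
      _ = _ := by ring

/-- If finite sets are approximable by finite-dimensional subalgebras, then this can be done with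
subalgebras containing a given orthogonal family of projections. -/
theorem exists_approx_containing_projections (h : HasApproxExtensions (⊥ : StarSubalgebra ℂ A))
    {ι : Type*} [DecidableEq ι] (p : ι → A) (hp : ∀ i, IsStarProjection (p i))
    (horth : Pairwise fun i j => p i * p j = 0) (S : Finset ι) :
    ∀ (F : Finset A) (ε : ℝ), 0 < ε → ∃ E : StarSubalgebra ℂ A, (∀ i ∈ S, p i ∈ E) ∧
      FiniteDimensional ℂ E ∧ ∀ x ∈ F, ∃ y ∈ E, ‖x - y‖ < ε := by
  classical
  induction S using Finset.induction_on with
  | empty =>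
    intro F ε hε
    obtain ⟨E, -, hE⟩ := h F ε hε
    exact ⟨E, by simp, hE⟩
  | insert j S hj ih =>
    intro F ε hε
    set K : ℝ := ∑ x ∈ F, ‖x‖ with hK
    have hK0 : 0 ≤ K := by positivity
    have hKF : ∀ x ∈ F, ‖x‖ ≤ K := fun x hx =>
      Finset.single_le_sum (f := fun x : A => ‖x‖) (fun _ _ => norm_nonneg _) hx
    set δ : ℝ := min (1 / 18) (ε / (54 * K + 2)) with hδ
    have hδ0 : 0 < δ := by positivity
    have hδ1 : δ ≤ 1 / 18 := min_le_left _ _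
    have hδε : δ * (54 * K + 2) ≤ ε := by
      rw [← le_div_iff₀ (by positivity)]; exact min_le_right _ _
    obtain ⟨E, hSE, hE, hFE⟩ := ih (insert (p j) F) δ hδ0
    obtain ⟨y, hyE, hy⟩ := hFE (p j) (Finset.mem_insert_self _ _)
    set e := ∑ i ∈ S, p i with he
    have heE : e ∈ E := sum_mem hSE
    have hije : ∀ i ∈ S, p i * e = p i := fun i hi => by
      rw [he, Finset.mul_sum, Finset.sum_eq_single i (fun k _ hk => horth hk.symm)
        (fun h => absurd hi h), (hp i).isIdempotentElem.eq]
    have hes : star e = e := by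
      rw [he, star_sum]
      exact Finset.sum_congr rfl fun i _ => (hp i).isSelfAdjoint.star_eq
    have hep : IsStarProjection e := by
      refine ⟨?_, hes⟩
      rw [IsIdempotentElem]
      nth_rw 1 [he]
      rw [Finset.sum_mul]
      exact Finset.sum_congr rfl hije
    have hej : e * p j = 0 := by
      rw [he, Finset.sum_mul]
      exact Finset.sum_eq_zero fun i hi => horth (ne_of_mem_of_not_mem hi hj)
    have hje : p j * e = 0 := by
      simpa [hes, (hp j).isSelfAdjoint.star_eq] using congrArg star hej
    set y' := (1 - e) * ((2⁻¹ : ℝ) • (y + star y)) * (1 - e) with hy'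
    have hsa : IsSelfAdjoint ((2⁻¹ : ℝ) • (y + star y)) :=
      (IsSelfAdjoint.all _).smul (IsSelfAdjoint.add_star_self y)
    have hy'sa : IsSelfAdjoint y' := by
      have := hsa.conjugate (1 - e)
      rwa [star_sub, star_one, hes] at this
    have hy'E : y' ∈ E := by
      have h1 : (1 - e) ∈ E := sub_mem (one_mem E) heE
      refine mul_mem (mul_mem h1 ?_) h1
      rw [← Complex.coe_smul]
      exact SMulMemClass.smul_mem _ (add_mem hyE (star_mem hyE))
    have hy'p : ‖y' - p j‖ ≤ δ := by
      have h1 : y' - p j = (1 - e) * ((2⁻¹ : ℝ) • ((y - p j) + star (y - p j))) * (1 - e) := by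
        have h2 : p j = (1 - e) * ((2⁻¹ : ℝ) • (p j + star (p j))) * (1 - e) := by
          rw [(hp j).isSelfAdjoint.star_eq, ← two_smul ℝ (p j), smul_smul]
          simp [sub_mul, mul_sub, hej, hje]
        conv_lhs => rw [h2]
        rw [hy', ← sub_mul, ← mul_sub, ← smul_sub, star_sub]
        congr 3
        abel
      have h2 : ‖1 - e‖ ≤ 1 := hep.one_sub.norm_le
      have h3 : ‖(2⁻¹ : ℝ) • ((y - p j) + star (y - p j))‖ ≤ δ := by
        rw [norm_smul]
        have := norm_add_le (y - p j) (star (y - p j))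
        rw [norm_star, norm_sub_rev] at this
        norm_num
        norm_num at this
        linarith
      rw [h1]
      calc _ ≤ ‖1 - e‖ * ‖(2⁻¹ : ℝ) • ((y - p j) + star (y - p j))‖ * ‖1 - e‖ :=
            (norm_mul_le _ _).trans (by gcongr; exact norm_mul_le _ _)
        _ ≤ 1 * δ * 1 := by gcongr
        _ = δ := by ring
    obtain ⟨q, hqE, hq, hqp, hzq⟩ := StarSubalgebra.exists_isStarProjection_near hy'E hy'sa (hp j)
      hy'p (by linarith)
    rw [norm_sub_rev] at hqp
    obtain ⟨u, hu, hupq, hu1, hur⟩ := (hp j).exists_unitary_intertwining hq hqp (by linarith)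
    have huu : star u * u = 1 := Unitary.star_mul_self_of_mem hu
    have huu' : u * star u = 1 := Unitary.mul_star_self_of_mem hu
    have hup : ∀ i ∈ S, u * p i = p i * u := fun i hi => by
      have hij : i ≠ j := ne_of_mem_of_not_mem hi hj
      have h1 : p i * q = 0 := hzq _ (by
        rw [hy', ← mul_assoc, ← mul_assoc, mul_sub (p i), hije i hi]; simp)
      have h2 : q * p i = 0 := by
        simpa [hq.isSelfAdjoint.star_eq, (hp i).isSelfAdjoint.star_eq] using congrArg star h1
      refine hur (p i) ?_ ?_
      · rw [commute_iff_eq, horth hij, horth hij.symm]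
      · rw [commute_iff_eq, h1, h2]
    have hsum : ∑ _i : Unit, star u * star (star u) = 1 := by simp [huu]
    refine ⟨E.ofCompressions (fun _ : Unit => star u) hsum (by simp [huu', one_mem]), ?_,
      inferInstance, fun x hx => ?_⟩
    · intro i hi
      rw [StarSubalgebra.mem_ofCompressions]
      rintro - -
      rw [star_star]
      rcases Finset.mem_insert.1 hi with rfl | hi
      · rw [hupq, mul_assoc, huu', mul_one]; exact hqE
      · rw [hup i hi, mul_assoc, huu', mul_one]; exact hSE i hi
    · obtain ⟨b, hbE, hb⟩ := hFE x (Finset.mem_insert_of_mem hx)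
      refine ⟨star u * b * u, ?_, ?_⟩
      · rw [StarSubalgebra.mem_ofCompressions]
        rintro - -
        have : star (star u) * (star u * b * u) * star u = (u * star u) * b * (u * star u) := by
          rw [star_star]; noncomm_ring
        rw [this, huu', one_mul, mul_one]
        exact hbE
      · have hun : ‖u‖ ≤ 1 := by
          have := CStarRing.norm_mem_unitary_mul 1 hu
          rw [mul_one] at this
          exact this.trans_le (IsStarProjection.one A).norm_le
        have h1 : x - star u * b * u = star u * (u - 1) * x - star u * x * (u - 1)
            + star u * (x - b) * u := by
          have : star u * (u - 1) * x = x - star u * x := by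
            rw [mul_sub, huu]; noncomm_ring
          rw [this]; noncomm_ring
        have hxb : ‖x - b‖ < δ := hb
        have hu0 : ‖star u‖ ≤ 1 := by rwa [norm_star]
        have hu2 : ‖u - 1‖ ≤ 27 * δ := by linarith
        have hxK := hKF x hx
        have h2 : ‖star u * (u - 1) * x‖ ≤ 1 * (27 * δ) * K :=
          (norm_mul_le _ _).trans (by gcongr; exact (norm_mul_le _ _).trans (by gcongr))
        have h3 : ‖star u * x * (u - 1)‖ ≤ 1 * K * (27 * δ) :=
          (norm_mul_le _ _).trans (by gcongr; exact (norm_mul_le _ _).trans (by gcongr))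
        have h4 : ‖star u * (x - b) * u‖ ≤ 1 * δ * 1 :=
          (norm_mul_le _ _).trans (by gcongr; exact (norm_mul_le _ _).trans (by gcongr))
        rw [h1]
        have h5 := norm_add_le (star u * (u - 1) * x - star u * x * (u - 1))
          (star u * (x - b) * u)
        have h6 := norm_sub_le (star u * (u - 1) * x) (star u * x * (u - 1))
        nlinarith

/-- A finite-dimensional commutative C⋆-algebra is spanned by orthogonal projections. -/
theorem StarSubalgebra.exists_orthogonal_projections (D : StarSubalgebra ℂ A)
    [FiniteDimensional ℂ D] (hcomm : ∀ x ∈ D, ∀ y ∈ D, x * y = y * x) :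
    ∃ (ι : Type u) (_ : Fintype ι) (p : ι → A), (∀ i, IsStarProjection (p i)) ∧
      (Pairwise fun i j => p i * p j = 0) ∧ ∀ x ∈ D, ∃ c : ι → ℂ, x = ∑ i, c i • p i := by
  classical
  have hclosed : IsClosed (D : Set A) :=
    Submodule.closed_of_finiteDimensional (Subalgebra.toSubmodule D.toSubalgebra)
  let _ : CommCStarAlgebra D :=
    { (inferInstance : CStarAlgebra D) with
      mul_comm := fun x y => Subtype.ext (hcomm x x.2 y y.2) }
  let X : Type u := WeakDual.characterSpace ℂ D
  have hfin : Finite X := by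
    have h1 := linearIndependent_algHom_toLinearMap ℂ D ℂ
    have h2 : Finite (D →ₐ[ℂ] ℂ) := h1.finite_of_isNoetherian
    refine Finite.of_injective (fun φ : X => WeakDual.CharacterSpace.toAlgHom φ) fun φ ψ h => ?_
    exact DFunLike.ext _ _ fun x => DFunLike.congr_fun h x
  let _ : Fintype X := Fintype.ofFinite X
  let Φ : D ≃⋆ₐ[ℂ] C(X, ℂ) := gelfandStarTransform D
  let δ : X → C(X, ℂ) := fun i => ⟨fun j => if i = j then 1 else 0, continuous_of_discreteTopology⟩
  let e : X → D := fun i => Φ.symm (δ i)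
  have hδ : ∀ i j, δ i * δ j = if i = j then δ i else 0 := fun i j => by
    ext k
    by_cases hij : i = j
    · subst hij; simp [δ]
    · by_cases hik : i = k
      · subst hik; simp [δ, hij, Ne.symm hij]
      · simp [δ, hij, hik]
  have hδs : ∀ i, star (δ i) = δ i := fun i => by
    ext k
    by_cases hik : i = k <;> simp [δ, hik]
  have hee : ∀ i j, e i * e j = if i = j then e i else 0 := fun i j => by
    simp only [e]
    rw [← map_mul, hδ]
    split_ifs <;> simp
  refine ⟨X, inferInstance, fun i => (e i : A), fun i => ⟨?_, ?_⟩, fun i j hij => ?_,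
    fun x hx => ⟨fun i => Φ ⟨x, hx⟩ i, ?_⟩⟩
  · simpa [IsIdempotentElem] using congrArg Subtype.val (hee i i)
  · have : star (e i) = e i := by simp only [e]; rw [← map_star, hδs]
    exact congrArg Subtype.val this
  · have := congrArg Subtype.val (hee i j)
    simpa [hij] using this
  · have h1 : Φ ⟨x, hx⟩ = ∑ i, (Φ ⟨x, hx⟩ i) • δ i := by
      ext k
      rw [ContinuousMap.sum_apply, Fintype.sum_eq_single k fun i hi => by simp [δ, hi]]
      simp [δ]
    have h2 := congrArg Φ.symm h1
    rw [Φ.symm_apply_apply, map_sum] at h2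
    have h3 := congrArg Subtype.val h2
    simpa [e] using h3

theorem HasApproxExtensions.of_commutative (h : HasApproxExtensions (⊥ : StarSubalgebra ℂ A))
    (D : StarSubalgebra ℂ A) [FiniteDimensional ℂ D]
    (hcomm : ∀ x ∈ D, ∀ y ∈ D, x * y = y * x) : HasApproxExtensions D := by
  classical
  intro F ε hε
  obtain ⟨ι, _, p, hp, horth, hspan⟩ := D.exists_orthogonal_projections hcomm
  obtain ⟨E, hpE, hE⟩ := exists_approx_containing_projections h p hp horth Finset.univ F ε hε
  refine ⟨E, fun x hx => ?_, hE⟩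
  obtain ⟨c, rfl⟩ := hspan x hx
  exact sum_mem fun i hi => SMulMemClass.smul_mem _ (hpE i hi)

theorem StarSubalgebra.exists_isSelfAdjoint_not_commute (D : StarSubalgebra ℂ A)
    (hD : ¬ ∀ x ∈ D, ∀ y ∈ D, x * y = y * x) :
    ∃ a ∈ D, IsSelfAdjoint a ∧ ∃ b ∈ D, a * b ≠ b * a := by
  by_contra! hall
  refine hD fun x hx y hy => ?_
  have h1 : (realPart x : A) ∈ D := by
    rw [realPart_apply_coe, ← Complex.coe_smul]
    exact SMulMemClass.smul_mem _ (add_mem hx (star_mem hx))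
  have h2 : (imaginaryPart x : A) ∈ D := by
    rw [imaginaryPart_apply_coe, ← Complex.coe_smul]
    exact SMulMemClass.smul_mem _ (SMulMemClass.smul_mem _ (sub_mem hx (star_mem hx)))
  conv_lhs => rw [← realPart_add_I_smul_imaginaryPart x]
  conv_rhs => rw [← realPart_add_I_smul_imaginaryPart x]
  rw [add_mul, mul_add, smul_mul_assoc, mul_smul_comm, hall _ h1 (realPart x).2 y hy,
    hall _ h2 (imaginaryPart x).2 y hy]

theorem StarSubalgebra.exists_isStarProjection_not_commute (D : StarSubalgebra ℂ A)
    [FiniteDimensional ℂ D] (hD : ¬ ∀ x ∈ D, ∀ y ∈ D, x * y = y * x) :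
    ∃ p ∈ D, IsStarProjection p ∧ ∃ b ∈ D, p * b ≠ b * p := by
  classical
  obtain ⟨a, haD, ha, b, hbD, hab⟩ := D.exists_isSelfAdjoint_not_commute hD
  by_contra! hall
  refine hab ?_
  have hfin := finite_real_spectrum haD
  have hc (f : ℝ → ℝ) : ContinuousOn f (spectrum ℝ a) := continuousOn_spectrum haD f
  have hsum : a = ∑ l ∈ hfin.toFinset, l • cfc (fun t : ℝ => if t = l then 1 else 0) a := by
    conv_lhs => rw [← cfc_id' ℝ a]
    simp_rw [← fun l : ℝ => cfc_const_mul l (fun t : ℝ => if t = l then (1 : ℝ) else 0) a (hc _)]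
    rw [← cfc_sum _ a _ fun _ _ => hc _]
    refine cfc_congr fun t ht => ?_
    simp only [Finset.sum_apply, mul_ite, mul_one, mul_zero]
    rw [Finset.sum_ite_eq]
    simp [ht]
  have hcomm : ∀ l : ℝ, cfc (fun t : ℝ => if t = l then 1 else 0) a * b =
      b * cfc (fun t : ℝ => if t = l then 1 else 0) a := fun l => by
    refine hall _ (cfc_mem haD _) ⟨?_, cfc_predicate _ a⟩ b hbD
    rw [IsIdempotentElem, ← cfc_mul _ _ a (hc _) (hc _)]
    exact cfc_congr fun t _ => by simp
  rw [hsum, Finset.sum_mul, Finset.mul_sum]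
  exact Finset.sum_congr rfl fun l _ => by rw [smul_mul_assoc, mul_smul_comm, hcomm]

/-- A noncommutative finite-dimensional C⋆-algebra contains a nonzero partial isometry `v` with
orthogonal initial and range projections. -/
theorem StarSubalgebra.exists_partialIsometry (D : StarSubalgebra ℂ A)
    [FiniteDimensional ℂ D] (hD : ¬ ∀ x ∈ D, ∀ y ∈ D, x * y = y * x) :
    ∃ v ∈ D, v ≠ 0 ∧ IsStarProjection (v * star v) ∧ v * v = 0 ∧ v * star v * v = v := by
  obtain ⟨p, hpD, hp, b, hbD, hpb⟩ := D.exists_isStarProjection_not_commute hD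
  have hpp := hp.isIdempotentElem.eq
  obtain ⟨x, hxD, hx0, hxx⟩ : ∃ x ∈ D, x ≠ 0 ∧ x * x = 0 := by
    have h1D : 1 - p ∈ D := sub_mem (one_mem D) hpD
    by_cases h : p * b * (1 - p) = 0
    · refine ⟨(1 - p) * b * p, mul_mem (mul_mem h1D hbD) hpD, fun h' => hpb ?_, ?_⟩
      · have e1 : p * b = p * b * p := by
          rw [← sub_eq_zero, ← h]; noncomm_ring
        have e2 : b * p = p * b * p := by
          rw [← sub_eq_zero, ← h']; noncomm_ring
        rw [e1, e2]
      · calc (1 - p) * b * p * ((1 - p) * b * p) = (1 - p) * b * (p * (1 - p)) * b * p := by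
              noncomm_ring
          _ = 0 := by rw [hp.mul_one_sub_self]; simp
    · refine ⟨p * b * (1 - p), mul_mem (mul_mem hpD hbD) h1D, h, ?_⟩
      calc p * b * (1 - p) * (p * b * (1 - p)) = p * b * ((1 - p) * p) * b * (1 - p) := by
            noncomm_ring
        _ = 0 := by rw [hp.one_sub_mul_self]; simp
  set a := x * star x with ha
  have haD : a ∈ D := mul_mem hxD (star_mem hxD)
  have hsa : IsSelfAdjoint a := IsSelfAdjoint.mul_star_self x
  have hc (f : ℝ → ℝ) : ContinuousOn f (spectrum ℝ a) := continuousOn_spectrum haD f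
  have hpos : ∀ t ∈ spectrum ℝ a, 0 ≤ t := fun t ht => spectrum_star_mul_self_nonneg (b := star x)
    t (by simpa using ht)
  set g := cfc (fun t : ℝ => (√t)⁻¹) a with hg
  have hgs : star g = g := (cfc_predicate (fun t : ℝ => (√t)⁻¹) a : IsSelfAdjoint g).star_eq
  have hga : Commute g a := (Commute.refl a).cfc_real _
  have hP : g * a * g = cfc (fun t : ℝ => (√t)⁻¹ * t * (√t)⁻¹) a := by
    rw [cfc_mul (fun t : ℝ => (√t)⁻¹ * t) _ a (hc _) (hc _), cfc_mul _ _ a (hc _) (hc _),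
      cfc_id' ℝ a]
  have hPsq : ∀ t ∈ spectrum ℝ a, (√t)⁻¹ * t * (√t)⁻¹ = if t = 0 then 0 else 1 := fun t ht => by
    split_ifs with h
    · simp [h]
    · have h1 := Real.mul_self_sqrt (hpos t ht)
      have h2 : √t ≠ 0 := fun h0 => h (by rw [← h1, h0, zero_mul])
      field_simp
      nlinarith
  have hPa : g * a * g * a = a := by
    conv_rhs => rw [← cfc_id' ℝ a]
    rw [hP]
    conv_lhs => enter [2]; rw [← cfc_id' ℝ a]
    rw [← cfc_mul _ _ a (hc _) (hc _)]
    refine cfc_congr fun t ht => ?_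
    simp only [hPsq t ht]
    split_ifs with h <;> simp [h]
  have hvv : g * x * star (g * x) = g * a * g := by
    rw [star_mul, hgs, ha]; noncomm_ring
  have hPx : g * a * g * x = x := by
    have hz : (g * a * g * x - x) * star (g * a * g * x - x) = 0 := by
      have : (g * a * g * x - x) * star (g * a * g * x - x) =
          (g * a * g * a - a) * star (g * a * g) - (g * a * g * a - a) := by
        rw [star_sub, star_mul (g * a * g) x, ha]; noncomm_ring
      rw [this, hPa]; simp
    exact sub_eq_zero.1 (CStarRing.mul_star_self_eq_zero_iff _ |>.1 hz)
  refine ⟨g * x, mul_mem (cfc_mem haD _) hxD, fun h => hx0 ?_, ?_, ?_, ?_⟩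
  · rw [← hPx, mul_assoc, h, mul_zero]
  · rw [hvv, hP]
    refine ⟨?_, cfc_predicate _ a⟩
    rw [IsIdempotentElem, ← cfc_mul _ _ a (hc _) (hc _)]
    refine cfc_congr fun t ht => ?_
    simp only [hPsq t ht]
    split_ifs <;> simp
  · have hxg : x * g * x = 0 := by
      have h0 : x * a = 0 := by rw [ha, ← mul_assoc, hxx, zero_mul]
      calc x * g * x = x * g * (g * a * g * x) := by rw [hPx]
        _ = x * (g * (g * a)) * (g * x) := by noncomm_ring
        _ = 0 := by rw [hga.eq, ← mul_assoc g, hga.eq, mul_assoc a, ← mul_assoc x, h0]; simp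
    rw [mul_assoc, ← mul_assoc x g x, hxg, mul_zero]
  · rw [hvv]
    have hcomm : Commute (g * a * g) g :=
      ((Commute.refl g).mul_left hga.symm).mul_left (Commute.refl g)
    rw [← mul_assoc, hcomm.eq, mul_assoc, hPx]

/-- The subalgebra `(1 - P) D (1 - P) + ℂ P`. -/
def StarSubalgebra.cornerSum (D : StarSubalgebra ℂ A) {P : A} (hP : IsStarProjection P) :
    StarSubalgebra ℂ A where
  carrier := {x | x ∈ D ∧ ∃ c : ℂ, x * P = c • P ∧ P * x = c • P}
  mul_mem' := by
    rintro x y ⟨hx, c, hc, hc'⟩ ⟨hy, d, hd, hd'⟩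
    refine ⟨mul_mem hx hy, c * d, ?_, ?_⟩
    · rw [mul_assoc, hd, mul_smul_comm, hc, smul_smul, mul_comm]
    · rw [← mul_assoc, hc', smul_mul_assoc, hd', smul_smul]
  add_mem' := by
    rintro x y ⟨hx, c, hc, hc'⟩ ⟨hy, d, hd, hd'⟩
    exact ⟨add_mem hx hy, c + d, by rw [add_mul, hc, hd, add_smul],
      by rw [mul_add, hc', hd', add_smul]⟩
  algebraMap_mem' r := ⟨algebraMap_mem D r, r, by simp [Algebra.algebraMap_eq_smul_one],
    by simp [Algebra.algebraMap_eq_smul_one]⟩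
  star_mem' := by
    rintro x ⟨hx, c, hc, hc'⟩
    refine ⟨star_mem hx, star c, ?_, ?_⟩
    · simpa [hP.isSelfAdjoint.star_eq] using congrArg star hc'
    · simpa [hP.isSelfAdjoint.star_eq] using congrArg star hc

theorem HasApproxExtensions.of_finiteDimensional
    (h : HasApproxExtensions (⊥ : StarSubalgebra ℂ A)) (D : StarSubalgebra ℂ A)
    [FiniteDimensional ℂ D] : HasApproxExtensions D := by
  induction hn : Module.finrank ℂ D using Nat.strong_induction_on generalizing D with
  | _ n ih =>
  by_cases hcomm : ∀ x ∈ D, ∀ y ∈ D, x * y = y * x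
  · exact h.of_commutative D hcomm
  obtain ⟨v, hvD, hv0, hP, hvv, hPv⟩ := D.exists_partialIsometry hcomm
  set P := v * star v with hPdef
  have hPD : P ∈ D := mul_mem hvD (star_mem hvD)
  have hPP := hP.isIdempotentElem.eq
  have hPs := hP.isSelfAdjoint.star_eq
  have hvP : v * P = 0 := by rw [hPdef, ← mul_assoc, hvv, zero_mul]
  set C := D.cornerSum hP with hC
  have hCD : C ≤ D := fun x hx => hx.1
  have hvC : v ∉ C := by
    rintro ⟨-, c, hc, hc'⟩
    rw [hvP] at hc
    rw [hPv, ← hc] at hc'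
    exact hv0 hc'
  have hsubm : Subalgebra.toSubmodule C.toSubalgebra < Subalgebra.toSubmodule D.toSubalgebra :=
    lt_of_le_of_ne hCD fun heq => hvC (by
      have : v ∈ Subalgebra.toSubmodule C.toSubalgebra := heq ▸ hvD
      exact this)
  have : FiniteDimensional ℂ (Subalgebra.toSubmodule D.toSubalgebra) := ‹FiniteDimensional ℂ D›
  have hCfin : FiniteDimensional ℂ C := Submodule.finiteDimensional_of_le hsubm.le
  have hrank : Module.finrank ℂ C < n := hn ▸ Submodule.finrank_lt_finrank_of_lt hsubm
  refine (ih _ hrank C rfl).of_compressions (fun b : Bool => if b then v else 1 - P) ?_ ?_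
  · simp only [Fintype.sum_bool, if_true, Bool.false_eq_true, if_false, star_sub, star_one, hPs]
    rw [← hPdef, hP.one_sub.isIdempotentElem.eq]
    abel
  · have hmem : ∀ b : Bool, (if b then v else 1 - P) ∈ D ∧ (if b then v else 1 - P) * P = 0 := by
      rintro (_ | _)
      · exact ⟨by simpa using sub_mem (one_mem D) hPD, by simp [sub_mul, hPP]⟩
      · exact ⟨by simpa using hvD, by simpa using hvP⟩
    intro d hd i j
    refine ⟨mul_mem (mul_mem (star_mem (hmem i).1) hd) (hmem j).1, 0, ?_, ?_⟩
    · rw [mul_assoc, (hmem j).2]; simp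
    · have := congrArg star (hmem i).2
      rw [star_mul, hPs, star_zero] at this
      rw [← mul_assoc, ← mul_assoc, this]; simp

end Extension

/-- Let `A` be a unital locally AF C*-algebra (every finite subset is
approximately contained in a finite-dimensional subalgebra) and `B₀ ⊆ A` a unital separable
C*-subalgebra.  Then there exists a unital separable AF C*-subalgebra `B` of `A` containing
`B₀`, where AF means that `B` is the closure of an increasing union of finite-dimensional
subalgebras. -/
theorem stmt15 {A : Type*} [CStarAlgebra A]
    (hLAF : ∀ (F : Finset A) (ε : ℝ), 0 < ε → ∃ D : StarSubalgebra ℂ A,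
      FiniteDimensional ℂ D ∧ ∀ x ∈ F, ∃ y ∈ D, ‖x - y‖ < ε)
    (B₀ : StarSubalgebra ℂ A) (hB₀closed : IsClosed (B₀ : Set A))
    (hB₀sep : TopologicalSpace.IsSeparable (B₀ : Set A)) :
    ∃ B : StarSubalgebra ℂ A, B₀ ≤ B ∧ IsClosed (B : Set A) ∧
      TopologicalSpace.IsSeparable (B : Set A) ∧
      ∃ D : ℕ → StarSubalgebra ℂ A, Monotone D ∧ (∀ n, FiniteDimensional ℂ (D n)) ∧
        (∀ n, D n ≤ B) ∧ closure (⋃ n, (D n : Set A)) = (B : Set A) := by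
  classical
  have hbot : HasApproxExtensions (⊥ : StarSubalgebra ℂ A) := fun F ε hε =>
    let ⟨E, hE⟩ := hLAF F ε hε
    ⟨E, bot_le, hE⟩
  obtain ⟨c, hc, hcB⟩ := hB₀sep
  obtain ⟨b, hb⟩ : ∃ b : ℕ → A, c ⊆ Set.range b := by
    rcases c.eq_empty_or_nonempty with rfl | hne
    · exact ⟨0, Set.empty_subset _⟩
    · obtain ⟨b, rfl⟩ := hc.exists_eq_range hne
      exact ⟨b, subset_rfl⟩
  have step : ∀ (n : ℕ) (D : {D : StarSubalgebra ℂ A // FiniteDimensional ℂ D}),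
      ∃ E : {D : StarSubalgebra ℂ A // FiniteDimensional ℂ D}, D.1 ≤ E.1 ∧
        ∀ k ≤ n, ∃ y ∈ E.1, ‖b k - y‖ < 1 / ((n : ℝ) + 1) := by
    rintro n ⟨D, hD⟩
    obtain ⟨E, hDE, hE, hF⟩ := hbot.of_finiteDimensional D ((Finset.range (n + 1)).image b)
      (1 / ((n : ℝ) + 1)) (by positivity)
    exact ⟨⟨E, hE⟩, hDE, fun k hk => hF _ (Finset.mem_image_of_mem b (by simp; omega))⟩
  choose next hle hnext using step
  let D : ℕ → {D : StarSubalgebra ℂ A // FiniteDimensional ℂ D} := fun n =>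
    Nat.rec ⟨⊥, inferInstanceAs (FiniteDimensional ℂ (⊥ : Subalgebra ℂ A))⟩ next n
  have hmono : Monotone fun n => (D n).1 := monotone_nat_of_le_succ fun n => hle n (D n)
  have hunion : ((⨆ n, (D n).1 : StarSubalgebra ℂ A) : Set A) = ⋃ n, ((D n).1 : Set A) :=
    StarSubalgebra.coe_iSup_of_directed hmono.directed_le
  refine ⟨(⨆ n, (D n).1).topologicalClosure, ?_, StarSubalgebra.isClosed_topologicalClosure _, ?_,
    fun n => (D n).1, hmono, fun n => (D n).2,
    fun n => (le_iSup (fun n => (D n).1) n).trans (StarSubalgebra.le_topologicalClosure _), ?_⟩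
  · have hcl : c ⊆ ((⨆ n, (D n).1).topologicalClosure : Set A) := by
      intro x hx
      obtain ⟨k, rfl⟩ := hb hx
      rw [StarSubalgebra.topologicalClosure_coe, hunion, Metric.mem_closure_iff]
      intro ε hε
      obtain ⟨m, hm⟩ := exists_nat_one_div_lt hε
      obtain ⟨y, hy, hyb⟩ := hnext (max k m) (D (max k m)) k (le_max_left _ _)
      refine ⟨y, Set.mem_iUnion.2 ⟨max k m + 1, hy⟩, ?_⟩
      rw [dist_eq_norm]
      refine (hyb.trans_le ?_).trans hm
      gcongr
      exact le_max_right _ _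
    intro x hx
    exact closure_minimal hcl (StarSubalgebra.isClosed_topologicalClosure _) (hcB hx)
  · rw [StarSubalgebra.topologicalClosure_coe, hunion]
    refine (TopologicalSpace.IsSeparable.iUnion fun n => ?_).closure
    have := (D n).2
    have : ProperSpace (D n).1 := FiniteDimensional.proper ℂ _
    exact TopologicalSpace.IsSeparable.of_subtype _
  · rw [StarSubalgebra.topologicalClosure_coe, hunion]
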